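/- For every acceptance mode (σ,ρ) with σ ∈ {ran, inf} and ρ ∈ {⊓, ⊆, =}, every ω-language (σ,ρ)-accepted by a Turing ω-machine is (σ,ρ,nl)-accepted by some context-sensitive ω-grammar: 𝓛_{σ,ρ}(ω-TM) ⊆ 𝓛_{σ,ρ,nl}(ω-CSG). -/

import Mathlib

namespace OmegaFormal

/-- σ component of an acceptance mode: `ran` (occurs at least once)
or `inf` (occurs infinitely often). -/
inductive AccSigma | ran | inf
deriving DecidableEq

/-- ρ component of an acceptance mode: `cap` (nonempty intersection, ⊓),
`sub` (⊆) or `eq` (=). -/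
inductive AccRho | cap | sub | eq
deriving DecidableEq

/-- derivation mode: leftmost (`l`) or normal (`nl`). -/
inductive DerivMode | l | nl
deriving DecidableEq

/-- `sigmaSet σ f` is ran(f) resp. inf(f). -/
def sigmaSet {Q : Type _} : AccSigma → (ℕ → Q) → Set Q
  | .ran, f => Set.range f
  | .inf, f => {q | ∀ n : ℕ, ∃ m : ℕ, n ≤ m ∧ f m = q}

/-- the binary relation denoted by ρ. -/
def rhoRel {Q : Type _} : AccRho → Set Q → Set Q → Prop
  | .cap, A, B => (A ∩ B).Nonempty
  | .sub, A, B => A ⊆ B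
  | .eq,  A, B => A = B

/-- f is (σ,ρ)-accepting w.r.t. the set 𝓕 of designated sets. -/
def IsAccepting {Q : Type _} (σ : AccSigma) (ρ : AccRho) (𝓕 : Set (Set Q)) (f : ℕ → Q) : Prop :=
  ∃ F ∈ 𝓕, rhoRel ρ (sigmaSet σ f) F

/-- the finite word `l` coincides with the prefix of the ω-word `u`. -/
def MatchesPrefix {T : Type _} (l : List T) (u : ℕ → T) : Prop :=
  ∀ (k : ℕ) (h : k < l.length), l.get ⟨k, h⟩ = u k

/-- the maximal terminal prefix of a sentential form. -/
def termPrefix {N T : Type _} : List (N ⊕ T) → List T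
  | [] => []
  | (Sum.inl _) :: _ => []
  | (Sum.inr a) :: l => a :: termPrefix l

/-- A phrase structure ω-grammar `G = (N, T, P, S, 𝓕)`:
`N` nonterminals, `T` terminals, `P` named productions `p : lhs p → rhs p`
with `lhs p ∈ N⁺`, `rhs p ∈ (N ∪ T)*`, start symbol, and
production repetition sets `acc ⊆ 2^P`. -/
structure OmegaPSG (T : Type) where
  N : Type
  [fintypeN : Fintype N]
  P : Type
  [fintypeP : Fintype P]
  lhs : P → List N
  lhs_ne : ∀ p : P, lhs p ≠ []
  rhs : P → List (N ⊕ T)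
  start : N
  acc : Set (Set P)

namespace OmegaPSG

variable {T : Type} (G : OmegaPSG T)

/-- one (normal) rewriting step using production p. -/
def Step (p : G.P) (x y : List (G.N ⊕ T)) : Prop :=
  ∃ u v : List (G.N ⊕ T),
    x = u ++ (G.lhs p).map Sum.inl ++ v ∧ y = u ++ G.rhs p ++ v

/-- one leftmost rewriting step: the rewritten occurrence starts at the
leftmost nonterminal, i.e. everything to its left is terminal. -/
def LStep (p : G.P) (x y : List (G.N ⊕ T)) : Prop :=
  ∃ u v : List (G.N ⊕ T), (∀ s ∈ u, ∃ a : T, s = Sum.inr a) ∧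
    x = u ++ (G.lhs p).map Sum.inl ++ v ∧ y = u ++ G.rhs p ++ v

def StepOf : DerivMode → G.P → List (G.N ⊕ T) → List (G.N ⊕ T) → Prop
  | .l => G.LStep
  | .nl => G.Step

/-- `L_{σ,ρ,π}(G)`: ω-words admitting an infinite π-derivation from S whose
growing terminal prefixes spell the word and whose production sequence is
(σ,ρ)-accepting w.r.t. `G.acc`. -/
def Lang (σ : AccSigma) (ρ : AccRho) (π : DerivMode) : Set (ℕ → T) :=
  {u | ∃ (s : ℕ → List (G.N ⊕ T)) (d : ℕ → G.P),
    s 0 = [Sum.inl G.start] ∧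
    (∀ i : ℕ, G.StepOf π (d i) (s i) (s (i + 1))) ∧
    (∀ n : ℕ, ∃ i : ℕ, n ≤ (termPrefix (s i)).length) ∧
    (∀ i : ℕ, MatchesPrefix (termPrefix (s i)) u) ∧
    IsAccepting σ ρ G.acc d}

/-- context-free: every left-hand side is a single nonterminal. -/
def IsCFG : Prop := ∀ p : G.P, (G.lhs p).length = 1

/-- context-sensitive (monotonic): `|β| ≥ |α|` for every production. -/
def IsCSG : Prop := ∀ p : G.P, (G.lhs p).length ≤ (G.rhs p).length

/-- right linear: productions of the form `A → uB` or `A → u`, `u ∈ T*`. -/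
def IsRLG : Prop :=
  ∀ p : G.P, (G.lhs p).length = 1 ∧
    ∃ (w : List T) (B : Option G.N),
      G.rhs p = w.map Sum.inr ++ B.toList.map Sum.inl

/-- `G` is a grammar with `$`-boundary (PSG version): with `$` = `dollar`,
`S` = `S'`, every production has one of the forms
(1) α → β, α,β ∈ N⁺ (N = nonterminals other than `$`, `S`),
(2) S → $α, α ∈ N⁺, (3) $A → a$, (4) A → ε. -/
def HasDollarBoundary (dollar S' : G.N) : Prop :=
  dollar ≠ S' ∧ G.start = S' ∧
  ∀ p : G.P,
    ((dollar ∉ G.lhs p ∧ S' ∉ G.lhs p) ∧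
      ∃ β : List G.N, β ≠ [] ∧ dollar ∉ β ∧ S' ∉ β ∧ G.rhs p = β.map Sum.inl) ∨
    (G.lhs p = [S'] ∧ ∃ α : List G.N, α ≠ [] ∧ dollar ∉ α ∧ S' ∉ α ∧
      G.rhs p = Sum.inl dollar :: α.map Sum.inl) ∨
    (∃ A : G.N, A ≠ dollar ∧ A ≠ S' ∧ G.lhs p = [dollar, A] ∧
      ∃ a : T, G.rhs p = [Sum.inr a, Sum.inl dollar]) ∨
    (∃ A : G.N, A ≠ dollar ∧ A ≠ S' ∧ G.lhs p = [A] ∧ G.rhs p = [])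

/-- `G` is a grammar with `$`-boundary (CSG version): forms (1)-(3) only,
with `|α| ≤ |β|` in form (1). -/
def HasDollarBoundaryCSG (dollar S' : G.N) : Prop :=
  dollar ≠ S' ∧ G.start = S' ∧
  ∀ p : G.P,
    ((dollar ∉ G.lhs p ∧ S' ∉ G.lhs p) ∧
      ∃ β : List G.N, β ≠ [] ∧ dollar ∉ β ∧ S' ∉ β ∧ (G.lhs p).length ≤ β.length ∧
        G.rhs p = β.map Sum.inl) ∨
    (G.lhs p = [S'] ∧ ∃ α : List G.N, α ≠ [] ∧ dollar ∉ α ∧ S' ∉ α ∧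
      G.rhs p = Sum.inl dollar :: α.map Sum.inl) ∨
    (∃ A : G.N, A ≠ dollar ∧ A ≠ S' ∧ G.lhs p = [dollar, A] ∧
      ∃ a : T, G.rhs p = [Sum.inr a, Sum.inl dollar])

end OmegaPSG

/-- `𝓛_{σ,ρ,π}(X)` for the family `X` of ω-grammars over `T` satisfying `C`. -/
def GLang (T : Type) (C : OmegaPSG T → Prop) (σ : AccSigma) (ρ : AccRho) (π : DerivMode) :
    Set (Set (ℕ → T)) :=
  {L | ∃ G : OmegaPSG T, C G ∧ L = G.Lang σ ρ π}

/-- number of non-ε labels among `b 0, …, b (i-1)`. -/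
def someCount {A : Type _} (b : ℕ → Option A) (i : ℕ) : ℕ :=
  ((Finset.range i).filter fun j => (b j).isSome = true).card

/-- the (ε-allowing) label sequence `b` concatenates to the ω-word `u`. -/
def Spells {A : Type _} (b : ℕ → Option A) (u : ℕ → A) : Prop :=
  (∀ n : ℕ, ∃ i : ℕ, n ≤ someCount b i) ∧
  ∀ i : ℕ, ∀ a : A, b i = some a → a = u (someCount b i)

/-- A finite state ω-automaton `(Q, Σ, δ, q₀, 𝓕)`. -/
structure OmegaFSA (Sig : Type) where
  Q : Type
  [fintypeQ : Fintype Q]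
  init : Q
  trans : Q → Option Sig → Q → Prop
  acc : Set (Set Q)

/-- `L_{σ,ρ}(A)` for a finite state ω-automaton. -/
def OmegaFSA.Lang {Sig : Type} (A : OmegaFSA Sig) (σ : AccSigma) (ρ : AccRho) :
    Set (ℕ → Sig) :=
  {u | ∃ (r : ℕ → A.Q) (b : ℕ → Option Sig),
    r 0 = A.init ∧ (∀ i : ℕ, A.trans (r i) (b i) (r (i + 1))) ∧
    Spells b u ∧ IsAccepting σ ρ A.acc r}

/-- `𝓛_{σ,ρ}(ω-FSA)`. -/
def FSALang (Sig : Type) (σ : AccSigma) (ρ : AccRho) : Set (Set (ℕ → Sig)) :=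
  {L | ∃ A : OmegaFSA Sig, L = A.Lang σ ρ}

/-- A pushdown ω-automaton `(Q, Σ, Γ, δ, q₀, Z₀, 𝓕)`. -/
structure OmegaPDA (Sig : Type) where
  Q : Type
  [fintypeQ : Fintype Q]
  Γ : Type
  [fintypeΓ : Fintype Γ]
  init : Q
  Z0 : Γ
  trans : Q → Option Sig → Γ → Q → List Γ → Prop
  acc : Set (Set Q)

/-- `L_{σ,ρ}(D)` for a pushdown ω-automaton. -/
def OmegaPDA.Lang {Sig : Type} (D : OmegaPDA Sig) (σ : AccSigma) (ρ : AccRho) :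
    Set (ℕ → Sig) :=
  {u | ∃ (q : ℕ → D.Q) (st : ℕ → List D.Γ) (b : ℕ → Option Sig),
    q 0 = D.init ∧ st 0 = [D.Z0] ∧
    (∀ i : ℕ, ∃ (Z : D.Γ) (γ rest : List D.Γ),
      st i = Z :: rest ∧ D.trans (q i) (b i) Z (q (i + 1)) γ ∧ st (i + 1) = γ ++ rest) ∧
    Spells b u ∧ IsAccepting σ ρ D.acc q}

/-- `𝓛_{σ,ρ}(ω-PDA)`. -/
def PDALang (Sig : Type) (σ : AccSigma) (ρ : AccRho) : Set (Set (ℕ → Sig)) :=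
  {L | ∃ D : OmegaPDA Sig, L = D.Lang σ ρ}

/-- tape head moves. -/
inductive Move | L | R | S
deriving DecidableEq

def moveHead : Move → ℕ → ℕ
  | .L, n => n - 1
  | .R, n => n + 1
  | .S, n => n

/-- A single-tape Turing ω-machine `(Q, Σ, Γ, δ, q₀, 𝓕)` (Σ ⊆ Γ via `embed`). -/
structure OmegaTM (Sig : Type) where
  Q : Type
  [fintypeQ : Fintype Q]
  Γ : Type
  [fintypeΓ : Fintype Γ]
  embed : Sig → Γ
  embed_inj : Function.Injective embed
  init : Q
  trans : Q → Γ → Q → Γ → Move → Prop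
  acc : Set (Set Q)

/-- `L_{σ,ρ}(M)`: ω-words admitting a complete non-oscillating run whose state
sequence is (σ,ρ)-accepting. -/
def OmegaTM.Lang {Sig : Type} (M : OmegaTM Sig) (σ : AccSigma) (ρ : AccRho) :
    Set (ℕ → Sig) :=
  {u | ∃ (q : ℕ → M.Q) (tape : ℕ → ℕ → M.Γ) (pos : ℕ → ℕ),
    q 0 = M.init ∧ (∀ n : ℕ, tape 0 n = M.embed (u n)) ∧ pos 0 = 0 ∧
    (∀ i : ℕ, ∃ (g : M.Γ) (m : Move),
      M.trans (q i) (tape i (pos i)) (q (i + 1)) g m ∧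
      tape (i + 1) = Function.update (tape i) (pos i) g ∧
      pos (i + 1) = moveHead m (pos i)) ∧
    (∀ n : ℕ, ∃ i : ℕ, n ≤ pos i) ∧
    (∀ n : ℕ, ∃ i0 : ℕ, ∀ i : ℕ, i0 ≤ i → pos i ≠ n) ∧
    IsAccepting σ ρ M.acc q}

/-- `𝓛_{σ,ρ}(ω-TM)`. -/
def TMLang (Sig : Type) (σ : AccSigma) (ρ : AccRho) : Set (Set (ℕ → Sig)) :=
  {L | ∃ M : OmegaTM Sig, L = M.Lang σ ρ}

/-- An m-tape Turing ω-machine. -/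
structure OmegaMTM (m : ℕ) (Sig : Type) where
  Q : Type
  [fintypeQ : Fintype Q]
  Γ : Type
  [fintypeΓ : Fintype Γ]
  embed : Sig → Γ
  embed_inj : Function.Injective embed
  blank : Γ
  init : Q
  trans : Q → (Fin m → Γ) → Q → (Fin m → Γ) → (Fin m → Move) → Prop
  acc : Set (Set Q)

/-- `L_{σ,ρ}(M)` for an m-tape Turing ω-machine (`hm : 0 < m`; the input is on
the first tape, the other tapes are initially blank; the run must be complete
and non-oscillating on the first tape). -/
def OmegaMTM.Lang {m : ℕ} {Sig : Type} (M : OmegaMTM m Sig) (hm : 0 < m)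
    (σ : AccSigma) (ρ : AccRho) : Set (ℕ → Sig) :=
  {u | ∃ (q : ℕ → M.Q) (tape : ℕ → Fin m → ℕ → M.Γ) (pos : ℕ → Fin m → ℕ),
    q 0 = M.init ∧
    (∀ n : ℕ, tape 0 ⟨0, hm⟩ n = M.embed (u n)) ∧
    (∀ j : Fin m, j ≠ ⟨0, hm⟩ → ∀ n : ℕ, tape 0 j n = M.blank) ∧
    (∀ j : Fin m, pos 0 j = 0) ∧
    (∀ i : ℕ, ∃ (g : Fin m → M.Γ) (mv : Fin m → Move),
      M.trans (q i) (fun j => tape i j (pos i j)) (q (i + 1)) g mv ∧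
      (∀ j : Fin m, tape (i + 1) j = Function.update (tape i j) (pos i j) (g j)) ∧
      (∀ j : Fin m, pos (i + 1) j = moveHead (mv j) (pos i j))) ∧
    (∀ n : ℕ, ∃ i : ℕ, n ≤ pos i ⟨0, hm⟩) ∧
    (∀ n : ℕ, ∃ i0 : ℕ, ∀ i : ℕ, i0 ≤ i → pos i ⟨0, hm⟩ ≠ n) ∧
    IsAccepting σ ρ M.acc q}

/-- `𝓛_{σ,ρ}(m-ω-TM)`. -/
def MTMLang (Sig : Type) (m : ℕ) (hm : 0 < m) (σ : AccSigma) (ρ : AccRho) :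
    Set (Set (ℕ → Sig)) :=
  {L | ∃ M : OmegaMTM m Sig, L = M.Lang hm σ ρ}

/-- the ω-language `{aⁿbⁿ | n ≥ 1}^ω` over the alphabet `Bool`
(`false` = a, `true` = b). -/
def abLang : Set (ℕ → Bool) :=
  {u | ∃ n : ℕ → ℕ, (∀ i : ℕ, 1 ≤ n i) ∧
    ∀ i k : ℕ, k < 2 * n i →
      u ((∑ j ∈ Finset.range i, 2 * n j) + k) = decide (n i ≤ k)}

end OmegaFormal
open OmegaFormal

namespace OmegaFormal

section Acceptance

variable {P Q : Type}

theorem sigmaSet_comp [Finite P] (σ : AccSigma) (g : P → Q) (d : ℕ → P) :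
    sigmaSet σ (g ∘ d) = g '' sigmaSet σ d := by
  cases σ with
  | ran => exact Set.range_comp g d
  | inf =>
    ext q
    simp only [sigmaSet, Set.mem_ofPred_eq, Set.mem_image, Function.comp_apply]
    constructor
    · intro h
      by_contra! hne
      have hbound : ∀ p : P, ∃ n, g p = q → ∀ m, n ≤ m → d m ≠ p := by
        intro p
        by_cases hp : ∀ n, ∃ m, n ≤ m ∧ d m = p
        · exact ⟨0, fun hg => absurd hg (hne p hp)⟩
        · push Not at hp
          exact hp.imp fun n hn _ => hn
      choose b hb using hbound
      obtain ⟨B, hB⟩ := (Set.finite_range b).bddAbove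
      obtain ⟨m, hm, hq⟩ := h B
      exact hb (d m) hq m ((hB ⟨d m, rfl⟩).trans hm) rfl
    · rintro ⟨p, hp, rfl⟩ n
      obtain ⟨m, hm, rfl⟩ := hp n
      exact ⟨m, hm, rfl⟩

theorem sigmaSet_tail (σ : AccSigma) (f : ℕ → Q) (h : f 0 = f 1) :
    sigmaSet σ (fun i => f (i + 1)) = sigmaSet σ f := by
  cases σ with
  | ran =>
    ext q
    constructor
    · rintro ⟨i, rfl⟩
      exact ⟨i + 1, rfl⟩
    · rintro ⟨_ | i, rfl⟩
      · exact ⟨0, h.symm⟩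
      · exact ⟨i, rfl⟩
  | inf =>
    ext q
    constructor
    · intro hq n
      obtain ⟨m, hm, rfl⟩ := hq n
      exact ⟨m + 1, by omega, rfl⟩
    · intro hq n
      obtain ⟨m, hm, rfl⟩ := hq (n + 1)
      obtain ⟨m, rfl⟩ : ∃ m', m = m' + 1 := ⟨m - 1, by omega⟩
      exact ⟨m, by omega, rfl⟩

/-- The designated sets over `P` that pull the acceptance condition `𝓕` back along `g`. -/
def pullAcc (ρ : AccRho) (g : P → Q) (𝓕 : Set (Set Q)) : Set (Set P) :=
  match ρ with
  | .eq => {A | g '' A ∈ 𝓕}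
  | _ => (fun F => g ⁻¹' F) '' 𝓕

theorem isAccepting_pullAcc [Finite P] (σ : AccSigma) (ρ : AccRho) (g : P → Q)
    (𝓕 : Set (Set Q)) (d : ℕ → P) :
    IsAccepting σ ρ (pullAcc ρ g 𝓕) d ↔ IsAccepting σ ρ 𝓕 (g ∘ d) := by
  unfold IsAccepting
  rw [sigmaSet_comp]
  cases ρ with
  | cap =>
    simp only [pullAcc, Set.exists_mem_image, rhoRel, Set.image_inter_nonempty_iff]
  | sub =>
    simp only [pullAcc, Set.exists_mem_image, rhoRel, Set.image_subset_iff]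
  | eq => simp [pullAcc, rhoRel]

end Acceptance

section Lists

variable {α N T : Type}

theorem exists_split_one {x y : List α} (k : ℕ) {a b : α} (ha : x[k]? = some a)
    (hb : y[k]? = some b) (h : ∀ j, j ≠ k → x[j]? = y[j]?) :
    ∃ u v, x = u ++ [a] ++ v ∧ y = u ++ [b] ++ v := by
  refine ⟨x.take k, x.drop (k + 1), ?_, ?_⟩ <;>
  · apply List.ext_getElem?
    intro j
    have := h j
    grind

theorem exists_split_two {x y : List α} (k : ℕ) {a a' b b' : α} (ha : x[k]? = some a)
    (ha' : x[k + 1]? = some a') (hb : y[k]? = some b) (hb' : y[k + 1]? = some b')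
    (h : ∀ j, j ≠ k → j ≠ k + 1 → x[j]? = y[j]?) :
    ∃ u v, x = u ++ [a, a'] ++ v ∧ y = u ++ [b, b'] ++ v := by
  refine ⟨x.take k, x.drop (k + 2), ?_, ?_⟩ <;>
  · apply List.ext_getElem?
    intro j
    have := h j
    grind

theorem exists_split_extend {x y : List α} (k : ℕ) {a a' b b' b'' : α} (hx : x.length = k + 2)
    (hy : y.length = k + 3) (ha : x[k]? = some a) (ha' : x[k + 1]? = some a')
    (hb : y[k]? = some b) (hb' : y[k + 1]? = some b') (hb'' : y[k + 2]? = some b'')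
    (h : ∀ j < k, x[j]? = y[j]?) :
    ∃ u v, x = u ++ [a, a'] ++ v ∧ y = u ++ [b, b', b''] ++ v := by
  refine ⟨x.take k, [], ?_, ?_⟩ <;>
  · apply List.ext_getElem?
    intro j
    have := h j
    grind

theorem termPrefix_getElem? (l : List (N ⊕ T)) (k : ℕ) (a : T)
    (h : (termPrefix l)[k]? = some a) : l[k]? = some (Sum.inr a) := by
  induction l generalizing k with
  | nil => simp [termPrefix] at h
  | cons x l ih =>
    cases x with
    | inl _ => simp [termPrefix] at h
    | inr b =>
      cases k with
      | zero => simpa [termPrefix] using h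
      | succ k => simpa using ih k (by simpa [termPrefix] using h)

theorem le_length_termPrefix (l : List (N ⊕ T)) (n : ℕ)
    (h : ∀ k < n, ∃ a, l[k]? = some (Sum.inr a)) : n ≤ (termPrefix l).length := by
  induction l generalizing n with
  | nil =>
    by_contra! hn
    obtain ⟨a, ha⟩ := h 0 (by omega)
    simp at ha
  | cons x l ih =>
    cases n with
    | zero => omega
    | succ n =>
      obtain ⟨a, ha⟩ := h 0 (by omega)
      obtain rfl : x = Sum.inr a := by simpa using ha
      have := ih n fun k hk => by simpa using h (k + 1) (by omega)
      simpa [termPrefix] using this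

end Lists

/-- Nonterminals of the simulating grammar. A `cell` carries the input letter, the current tape
letter, whether it is the leftmost cell, and the state if the head is there; `edge` marks the end
of the part of the tape visited so far. -/
inductive Sym (T Γ Q : Type)
  | start
  | edge
  | cell (a : T) (g : Γ) (first : Bool) (h : Option Q)
deriving Fintype

/-- The data of a machine step at one cell: states before and after, input letter, tape letters
before and after, and whether the cell is the leftmost one. -/
structure Act (T Γ Q : Type) where
  q : Q
  q' : Q
  a : T
  g : Γ
  g' : Γ
  first : Bool
deriving Fintype

/-- Names of productions of the simulating grammar. In `right` and `extend` the flag `last` tells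
whether the cell left by the head is turned into a terminal. -/
inductive Rule (T Γ Q : Type)
  | start (a : T)
  | stay (t : Act T Γ Q)
  | left (t : Act T Γ Q) (b : T) (h : Γ) (first : Bool)
  | right (last : Bool) (t : Act T Γ Q) (b : T) (h : Γ) (first : Bool)
  | extend (last : Bool) (t : Act T Γ Q) (b : T)
deriving Fintype

namespace OmegaTM

variable {T : Type} (M : OmegaTM T)

/-- Rules that are backed by a transition of `M`. -/
def Valid : Rule T M.Γ M.Q → Prop
  | .start _ => True
  | .stay t => M.trans t.q t.g t.q' t.g' .S ∨ M.trans t.q t.g t.q' t.g' .L ∧ t.first = true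
  | .left t _ _ _ => M.trans t.q t.g t.q' t.g' .L
  | .right _ t _ _ _ => M.trans t.q t.g t.q' t.g' .R
  | .extend _ t _ => M.trans t.q t.g t.q' t.g' .R

/-- The state in which a rule is applied. -/
def ruleState : Rule T M.Γ M.Q → M.Q
  | .start _ => M.init
  | .stay t => t.q
  | .left t _ _ _ => t.q
  | .right _ t _ _ _ => t.q
  | .extend _ t _ => t.q

def ruleLhs : Rule T M.Γ M.Q → List (Sym T M.Γ M.Q)
  | .start _ => [.start]
  | .stay t => [.cell t.a t.g t.first (some t.q)]
  | .left t b h first => [.cell b h first none, .cell t.a t.g t.first (some t.q)]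
  | .right _ t b h first => [.cell t.a t.g t.first (some t.q), .cell b h first none]
  | .extend _ t _ => [.cell t.a t.g t.first (some t.q), .edge]

/-- The symbol left behind by the head when it moves to the right. -/
def leave (last : Bool) (t : Act T M.Γ M.Q) : Sym T M.Γ M.Q ⊕ T :=
  if last then .inr t.a else .inl (.cell t.a t.g' t.first none)

def ruleRhs : Rule T M.Γ M.Q → List (Sym T M.Γ M.Q ⊕ T)
  | .start a => [.inl (.cell a (M.embed a) true (some M.init)), .inl .edge]
  | .stay t => [.inl (.cell t.a t.g' t.first (some t.q'))]
  | .left t b h first =>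
      [.inl (.cell b h first (some t.q')), .inl (.cell t.a t.g' t.first none)]
  | .right last t b h first => [M.leave last t, .inl (.cell b h first (some t.q'))]
  | .extend last t b =>
      [M.leave last t, .inl (.cell b (M.embed b) false (some t.q')), .inl .edge]

/-- Rewriting a sentential form by a rule. -/
def Rewrites (p : Rule T M.Γ M.Q) (x y : List (Sym T M.Γ M.Q ⊕ T)) : Prop :=
  ∃ v w, x = v ++ (M.ruleLhs p).map Sum.inl ++ w ∧ y = v ++ M.ruleRhs p ++ w

/-- The context-sensitive grammar simulating `M`: every derivation step after the first one is
one step of `M`. -/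
noncomputable def grammar [Fintype T] (ρ : AccRho) : OmegaPSG T :=
  letI := M.fintypeQ
  letI := M.fintypeΓ
  { N := Sym T M.Γ M.Q
    P := {p : Rule T M.Γ M.Q // M.Valid p}
    fintypeP := Fintype.ofFinite _
    lhs := fun p => M.ruleLhs p.1
    lhs_ne := by rintro ⟨_ | _, _⟩ <;> simp [ruleLhs]
    rhs := fun p => M.ruleRhs p.1
    start := .start
    acc := pullAcc ρ (fun p => M.ruleState p.1) M.acc }

theorem grammar_isCSG [Fintype T] (ρ : AccRho) : (M.grammar ρ).IsCSG := by
  rintro ⟨_ | _, _⟩ <;> simp [grammar, ruleLhs, ruleRhs]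

theorem mem_lang_grammar [Fintype T] (σ : AccSigma) (ρ : AccRho) (u : ℕ → T) :
    u ∈ (M.grammar ρ).Lang σ ρ .nl ↔
      ∃ (s : ℕ → List (Sym T M.Γ M.Q ⊕ T)) (d : ℕ → Rule T M.Γ M.Q),
        s 0 = [.inl .start] ∧ (∀ i, M.Valid (d i) ∧ M.Rewrites (d i) (s i) (s (i + 1))) ∧
        (∀ n, ∃ i, n ≤ (termPrefix (s i)).length) ∧
        (∀ i, MatchesPrefix (termPrefix (s i)) u) ∧
        IsAccepting σ ρ M.acc (M.ruleState ∘ d) := by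
  have : Finite (M.grammar ρ).P := @Finite.of_fintype _ (M.grammar ρ).fintypeP
  have hacc (d : ℕ → (M.grammar ρ).P) : IsAccepting σ ρ (M.grammar ρ).acc d ↔
      IsAccepting σ ρ M.acc (fun i => M.ruleState (d i).1) :=
    isAccepting_pullAcc σ ρ _ M.acc d
  constructor
  · rintro ⟨s, d, h0, hstep, hlen, hmatch, h⟩
    exact ⟨s, fun i => (d i).1, h0, fun i => ⟨(d i).2, hstep i⟩, hlen, hmatch, (hacc d).1 h⟩
  · rintro ⟨s, d, h0, hstep, hlen, hmatch, h⟩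
    exact ⟨s, fun i => ⟨d i, (hstep i).1⟩, h0, fun i => (hstep i).2, hlen, hmatch,
      (hacc fun i => ⟨d i, (hstep i).1⟩).2 h⟩

/-- A single step of `M` between configurations. -/
def Trans (q : M.Q) (tape : ℕ → M.Γ) (pos : ℕ) (q' : M.Q) (tape' : ℕ → M.Γ) (pos' : ℕ) : Prop :=
  ∃ (g : M.Γ) (m : Move), M.trans q (tape pos) q' g m ∧
    tape' = Function.update tape pos g ∧ pos' = moveHead m pos

/-- A configuration of `M` along with the bookkeeping of the grammar: the `width` of the visited
part of the tape and the set `done` of cells already turned into terminals. -/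
structure Config where
  q : M.Q
  tape : ℕ → M.Γ
  pos : ℕ
  width : ℕ
  done : Set ℕ

variable {M}

open Classical in
/-- The symbol standing for cell `k` of a configuration, for input `u`. -/
noncomputable def Config.sym (u : ℕ → T) (C : M.Config) (k : ℕ) : Sym T M.Γ M.Q ⊕ T :=
  if k ∈ C.done then .inr (u k)
  else .inl (.cell (u k) (C.tape k) (decide (k = 0)) (if k = C.pos then some C.q else none))

/-- The sentential form representing a configuration, for input `u`. -/
noncomputable def Config.form (u : ℕ → T) (C : M.Config) : List (Sym T M.Γ M.Q ⊕ T) :=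
  (List.range C.width).map (C.sym u) ++ [.inl .edge]

/-- Invariant of the simulation. -/
structure Config.Good (u : ℕ → T) (C : M.Config) : Prop where
  pos_lt : C.pos < C.width
  pos_notMem : C.pos ∉ C.done
  lt_of_mem : ∀ k ∈ C.done, k < C.width
  tape_eq : ∀ k, C.width ≤ k → C.tape k = M.embed (u k)

theorem Config.form_getElem? (u : ℕ → T) (C : M.Config) (k : ℕ) :
    (C.form u)[k]? =
      if k < C.width then some (C.sym u k) else if k = C.width then some (.inl .edge) else none := by
  simp only [form]
  grind

theorem Config.length_form (u : ℕ → T) (C : M.Config) : (C.form u).length = C.width + 1 := by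
  simp [form]

theorem Config.form_eq_head {u : ℕ → T} {C : M.Config} {k : ℕ} {a : T} {g : M.Γ} {f : Bool}
    {q : M.Q} (h : (C.form u)[k]? = some (.inl (.cell a g f (some q)))) :
    k = C.pos ∧ k < C.width ∧ a = u k ∧ g = C.tape k ∧ f = decide (k = 0) ∧ q = C.q := by
  rw [form_getElem?] at h
  unfold sym at h
  grind

theorem Config.form_eq_cell {u : ℕ → T} {C : M.Config} {k : ℕ} {a : T} {g : M.Γ} {f : Bool}
    (h : (C.form u)[k]? = some (.inl (.cell a g f none))) :
    k ≠ C.pos ∧ k < C.width ∧ k ∉ C.done ∧ a = u k ∧ g = C.tape k ∧ f = decide (k = 0) := by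
  rw [form_getElem?] at h
  unfold sym at h
  grind

theorem Config.form_eq_edge {u : ℕ → T} {C : M.Config} {k : ℕ}
    (h : (C.form u)[k]? = some (.inl .edge)) : k = C.width := by
  rw [form_getElem?] at h
  unfold sym at h
  grind

theorem Config.form_eq_terminal {u : ℕ → T} {C : M.Config} {k : ℕ} {a : T}
    (h : (C.form u)[k]? = some (.inr a)) : k ∈ C.done ∧ a = u k := by
  rw [form_getElem?] at h
  unfold sym at h
  grind

/-- The input letter carried by a symbol. -/
def letter : Sym T M.Γ M.Q ⊕ T → Option T
  | .inl (.cell a _ _ _) => some a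
  | .inl _ => none
  | .inr a => some a

theorem letter_leave (last : Bool) (t : Act T M.Γ M.Q) : letter (M.leave last t) = some t.a := by
  cases last <;> rfl

/-- Every rewriting step of a represented configuration that is consistent with the input is a step
of `M`. -/
theorem Config.exists_of_rewrites {u : ℕ → T} {C : M.Config} (hC : C.Good u)
    {p : Rule T M.Γ M.Q} (hp : M.Valid p) {y : List (Sym T M.Γ M.Q ⊕ T)}
    (hy : M.Rewrites p (C.form u) y) (hu : ∀ k a, y[k]?.bind letter = some a → a = u k) :
    ∃ C' : M.Config, y = C'.form u ∧ C'.Good u ∧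
      M.Trans C.q C.tape C.pos C'.q C'.tape C'.pos ∧ M.ruleState p = C.q ∧
      C.done ⊆ C'.done := by
  obtain ⟨v, w, hx, rfl⟩ := hy
  obtain ⟨h1, h2, hlt, h3⟩ := hC
  have hform := C.form_getElem? u
  have hupd (g : M.Γ) (k : ℕ) (hk : C.width ≤ k) :
      Function.update C.tape C.pos g k = M.embed (u k) := by
    rw [Function.update_of_ne (by omega), h3 k hk]
  cases p with
  | start a =>
    have h := hform v.length
    rw [hx] at h
    unfold sym at h
    simp [ruleLhs] at h
    grind
  | stay t =>
    have h : (C.form u)[v.length]? = some (.inl (.cell t.a t.g t.first (some t.q))) := by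
      rw [hx]; simp [ruleLhs]
    obtain ⟨hk, -, ha, hg, hf, hq⟩ := form_eq_head h
    refine ⟨⟨t.q', Function.update C.tape C.pos t.g', C.pos, C.width, C.done⟩, ?_,
      ⟨h1, h2, hlt, hupd _⟩, ?_, hq, subset_rfl⟩
    · apply List.ext_getElem?
      intro j
      have hj := hform j
      rw [form_getElem?]
      simp only [hx, ruleLhs, ruleRhs, sym] at hj ⊢
      grind
    · obtain ht | ⟨ht, hf'⟩ := hp
      · exact ⟨t.g', .S, by grind, rfl, rfl⟩
      · refine ⟨t.g', .L, by grind, rfl, ?_⟩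
        simp only [moveHead]
        grind
  | left t b h f =>
    have hb : (C.form u)[v.length]? = some (.inl (.cell b h f none)) := by
      rw [hx]; simp [ruleLhs]
    have ha : (C.form u)[v.length + 1]? = some (.inl (.cell t.a t.g t.first (some t.q))) := by
      rw [hx]; simp [ruleLhs]
    obtain ⟨hk, -, ha, hg, hf, hq⟩ := form_eq_head ha
    obtain ⟨-, hw, hd, hb, hh, hf'⟩ := form_eq_cell hb
    refine ⟨⟨t.q', Function.update C.tape C.pos t.g', v.length, C.width, C.done⟩, ?_,
      ⟨hw, hd, hlt, hupd _⟩, ⟨t.g', .L, ?_, rfl, ?_⟩, hq, subset_rfl⟩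
    · apply List.ext_getElem?
      intro j
      have hj := hform j
      rw [form_getElem?]
      simp only [hx, ruleLhs, ruleRhs, sym] at hj ⊢
      grind
    · simp only [Valid] at hp
      grind
    · simp only [moveHead]
      omega
  | right last t b h f =>
    have ha : (C.form u)[v.length]? = some (.inl (.cell t.a t.g t.first (some t.q))) := by
      rw [hx]; simp [ruleLhs]
    have hb : (C.form u)[v.length + 1]? = some (.inl (.cell b h f none)) := by
      rw [hx]; simp [ruleLhs]
    obtain ⟨hk, -, ha, hg, hf, hq⟩ := form_eq_head ha
    obtain ⟨-, hw, hd, hb, hh, hf'⟩ := form_eq_cell hb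
    refine ⟨⟨t.q', Function.update C.tape C.pos t.g', v.length + 1, C.width,
      {k | k ∈ C.done ∨ k = C.pos ∧ last = true}⟩, ?_,
      ⟨hw, by simp; grind, by simp; grind, hupd _⟩, ⟨t.g', .R, ?_, rfl, ?_⟩, hq, fun k => Or.inl⟩
    · apply List.ext_getElem?
      intro j
      have hj := hform j
      rw [form_getElem?]
      simp only [hx, ruleLhs, ruleRhs, sym, leave, Set.mem_ofPred_eq] at hj ⊢
      grind
    · simp only [Valid] at hp
      grind
    · simp only [moveHead]
      omega
  | extend last t b =>
    have ha : (C.form u)[v.length]? = some (.inl (.cell t.a t.g t.first (some t.q))) := by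
      rw [hx]; simp [ruleLhs]
    have hb : (C.form u)[v.length + 1]? = some (.inl .edge) := by
      rw [hx]; simp [ruleLhs]
    obtain ⟨hk, -, ha, hg, hf, hq⟩ := form_eq_head ha
    have hw := form_eq_edge hb
    have hlen := C.length_form u
    have hnil : w = [] := by
      rw [hx] at hlen
      simp [ruleLhs] at hlen
      exact List.eq_nil_of_length_eq_zero (by omega)
    subst hnil
    have hbu : b = u (v.length + 1) := hu (v.length + 1) b (by simp [ruleRhs, letter])
    refine ⟨⟨t.q', Function.update C.tape C.pos t.g', v.length + 1, C.width + 1,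
      {k | k ∈ C.done ∨ k = C.pos ∧ last = true}⟩, ?_,
      ⟨by simp; omega, by simp; grind, by simp; grind,
        fun k hk => hupd _ k (by simp at hk; omega)⟩,
      ⟨t.g', .R, ?_, rfl, ?_⟩, hq, fun k => Or.inl⟩
    · apply List.ext_getElem?
      intro j
      have hj := hform j
      have hn := h3 C.width le_rfl
      have hd : C.width ∉ C.done := fun h => (hlt _ h).false
      clear hu hlt h3 hform hupd hp hb
      rw [form_getElem?]
      simp only [hx, ruleLhs, ruleRhs, sym, leave, Set.mem_ofPred_eq] at hj ⊢
      clear hx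
      rcases lt_trichotomy j (v.length + 1) with hjl | rfl | hjl
      · grind
      · grind
      · grind
    · simp only [Valid] at hp
      grind
    · simp only [moveHead]
      omega

/-- Every step of `M` is a rewriting step between represented configurations, provided that a cell
is turned into a terminal only when the head leaves it to the right. -/
theorem Config.exists_rewrites (u : ℕ → T) {C C' : M.Config} (hpos : C.pos < C.width)
    (htape : ∀ k, C.width ≤ k → C.tape k = M.embed (u k))
    (hwidth : C'.width = max C.width (C'.pos + 1))
    (hdone : ∀ k, k ≠ C.pos → (k ∈ C'.done ↔ k ∈ C.done))
    (hlast : C.pos ∈ C'.done → C'.pos = C.pos + 1)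
    (h : C.pos ∉ C.done) (h' : C'.pos ∉ C.done)
    (ht : M.Trans C.q C.tape C.pos C'.q C'.tape C'.pos) :
    ∃ p, M.Valid p ∧ M.ruleState p = C.q ∧ M.Rewrites p (C.form u) (C'.form u) := by
  obtain ⟨g', m, ht, htape', hmove⟩ := ht
  let t : Act T M.Γ M.Q := ⟨C.q, C'.q, u C.pos, C.tape C.pos, g', decide (C.pos = 0)⟩
  have hstay (he : C'.pos = C.pos) :
      M.Rewrites (.stay t) (C.form u) (C'.form u) := by
    refine exists_split_one C.pos ?_ ?_ ?_
    · simp [form_getElem?, sym, t, hpos, h]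
    · have := mt hlast
      simp [form_getElem?, sym, t, hpos, htape', he, hwidth]
      grind
    · intro j hj
      have := hdone j hj
      simp only [form_getElem?, sym, htape']
      grind
  cases m with
  | S =>
    exact ⟨.stay t, Or.inl ht, rfl, hstay hmove⟩
  | L =>
    obtain h0 | ⟨k, hk⟩ : C.pos = 0 ∨ ∃ k, C.pos = k + 1 := by
      cases C.pos <;> simp
    · exact ⟨.stay t, Or.inr ⟨ht, by simp [t, h0]⟩, rfl, hstay (by simp [hmove, moveHead, h0])⟩
    · have hk' : C'.pos = k := by simp [hmove, moveHead, hk]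
      refine ⟨.left t (u k) (C.tape k) (decide (k = 0)), ht, rfl, ?_⟩
      refine exists_split_two k ?_ ?_ ?_ ?_ ?_
      · simp only [form_getElem?, sym]
        grind
      · rw [← hk]
        simp [form_getElem?, sym, t, hpos, h]
      · simp only [form_getElem?, sym, htape', t]
        grind
      · have hn : C.pos ∉ C'.done := fun hm => by have := hlast hm; omega
        have hne : C.pos ≠ C'.pos := by omega
        have hlt : C.pos < C'.width := by omega
        rw [← hk]
        simp [form_getElem?, sym, t, htape', hn, hne, hlt]
      · intro j hj hj'
        have := hdone j (by omega)
        simp only [form_getElem?, sym, htape']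
        grind
  | R =>
    classical
    have hk : C'.pos = C.pos + 1 := hmove
    have hleave : (C'.form u)[C.pos]? = some (M.leave (decide (C.pos ∈ C'.done)) t) := by
      simp only [form_getElem?, sym, htape', t, leave]
      grind
    rcases Nat.lt_or_ge (C.pos + 1) C.width with hlt | hge
    · refine ⟨.right (decide (C.pos ∈ C'.done)) t (u (C.pos + 1)) (C.tape (C.pos + 1)) false,
        ht, rfl, ?_⟩
      refine exists_split_two C.pos ?_ ?_ hleave ?_ ?_
      · simp only [form_getElem?, sym, t]
        grind
      · simp only [form_getElem?, sym]
        grind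
      · simp only [form_getElem?, sym, htape', t]
        grind
      · intro j hj hj'
        have := hdone j hj
        simp only [form_getElem?, sym, htape']
        grind
    · have hw : C.width = C.pos + 1 := by omega
      have hw' : C'.width = C.pos + 2 := by omega
      have hn := htape (C.pos + 1) hge
      refine ⟨.extend (decide (C.pos ∈ C'.done)) t (u (C.pos + 1)), ht, rfl, ?_⟩
      refine exists_split_extend C.pos ?_ ?_ ?_ ?_ hleave ?_ ?_ ?_
      · rw [length_form, hw]
      · rw [length_form, hw']
      · simp [form_getElem?, sym, t, hpos, h]
      · simp [form_getElem?, hw]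
      · have := hdone (C.pos + 1) (by omega)
        have hd : C.pos + 1 ∉ C'.done := by rwa [this, ← hk]
        simp [form_getElem?, sym, hw', hd, htape', hn, hk, t]
      · simp [form_getElem?, hw']
      · intro j hj
        have := hdone j (by omega)
        simp only [form_getElem?, sym, htape']
        grind

/-- Sentential forms ending in their only symbol without input letter. -/
def Shaped (x : List (Sym T M.Γ M.Q ⊕ T)) : Prop :=
  ∃ l, x = l ++ [.inl .edge] ∧ ∀ z ∈ l, letter z ≠ none

theorem Shaped.rewrites {x y : List (Sym T M.Γ M.Q ⊕ T)} (hx : Shaped x) {p : Rule T M.Γ M.Q}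
    (h : M.Rewrites p x y) :
    Shaped y ∧ ∀ (k : ℕ) (a : T), x[k]?.bind letter = some a → y[k]?.bind letter = some a := by
  obtain ⟨l, rfl, hl⟩ := hx
  obtain ⟨v, w, hx, rfl⟩ := h
  have keep (hne : (M.ruleLhs p).getLast? ≠ some .edge)
      (hlet : (M.ruleRhs p).map letter = ((M.ruleLhs p).map Sum.inl).map letter) :
      Shaped (v ++ M.ruleRhs p ++ w) ∧
        ∀ (k : ℕ) (a : T), (l ++ [Sum.inl Sym.edge])[k]?.bind letter = some a →
        (v ++ M.ruleRhs p ++ w)[k]?.bind letter = some a := by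
    obtain rfl | ⟨w, z, rfl⟩ := w.eq_nil_or_concat'
    · exfalso
      have h := congrArg List.getLast? hx
      clear hx hlet hl
      cases p <;> simp_all [ruleLhs]
    · rw [← List.append_assoc] at hx
      obtain ⟨rfl, hz⟩ := List.append_inj' hx rfl
      have hmap : (v ++ M.ruleRhs p ++ (w ++ [z])).map letter =
          (v ++ (M.ruleLhs p).map Sum.inl ++ w ++ [Sum.inl Sym.edge]).map letter := by
        simp_all
      refine ⟨⟨v ++ M.ruleRhs p ++ w, by simp_all, ?_⟩, ?_⟩
      · intro y hy hn
        have : none ∈ (v ++ (M.ruleLhs p).map Sum.inl ++ w).map letter := by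
          have : none ∈ (v ++ M.ruleRhs p ++ w).map letter := List.mem_map.2 ⟨y, hy, hn⟩
          simpa only [List.map_append, hlet] using this
        obtain ⟨y', hy', hn'⟩ := List.mem_map.1 this
        exact hl y' hy' hn'
      · intro k a hk
        have := congrArg (fun l => l[k]?.bind id) hmap
        simp only [List.getElem?_map, Option.bind_map, Function.id_comp] at this
        rw [this, hk]
  cases p with
  | start a =>
    have : Sum.inl Sym.start ∈ l ++ [(Sum.inl Sym.edge : Sym T M.Γ M.Q ⊕ T)] := by
      rw [hx]; simp [ruleLhs]
    exact absurd rfl (hl (Sum.inl Sym.start) (by simpa using this))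
  | stay t => exact keep (by simp [ruleLhs]) rfl
  | left t b h f => exact keep (by simp [ruleLhs]) (by simp [ruleLhs, ruleRhs, letter])
  | right last t b h f =>
    exact keep (by simp [ruleLhs]) (by simp [ruleLhs, ruleRhs, letter_leave]; simp [letter])
  | extend last t b =>
    obtain rfl | ⟨w, z, rfl⟩ := w.eq_nil_or_concat'
    · obtain ⟨rfl, -⟩ := List.append_inj' (t₁ := [_]) (s₂ := v ++ [_]) (t₂ := [_])
        (by simpa [ruleLhs] using hx) rfl
      refine ⟨⟨v ++ [M.leave last t, .inl (.cell b (M.embed b) false (some t.q'))],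
        by simp [ruleRhs], ?_⟩, ?_⟩
      · intro y hy
        simp only [List.mem_append, List.mem_cons, List.not_mem_nil, or_false] at hy
        obtain hy | rfl | rfl := hy
        · exact hl y (by simp [hy])
        · simp [letter_leave]
        · simp [letter]
      · intro k a
        have := letter_leave last t
        simp only [ruleRhs]
        rcases lt_trichotomy k v.length with hk | rfl | hk
        · simp [List.getElem?_append, hk]
        · simp [this]
          simp [letter]
        · simp [List.getElem?_append, hk.not_gt]
          grind [letter]
    · rw [← List.append_assoc] at hx
      obtain ⟨rfl, hz⟩ := List.append_inj' hx rfl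
      exact absurd rfl (hl (Sum.inl Sym.edge) (by simp [ruleLhs]))

/-- The sentential form after the first derivation step. -/
theorem rewrites_start {p : Rule T M.Γ M.Q} {y : List (Sym T M.Γ M.Q ⊕ T)}
    (h : M.Rewrites p [.inl .start] y) :
    ∃ a, p = .start a ∧ y = [.inl (.cell a (M.embed a) true (some M.init)), .inl .edge] := by
  obtain ⟨v, w, hx, rfl⟩ := h
  cases p <;> cases v <;> simp_all [ruleLhs, ruleRhs]

/-- The initial configuration. -/
def Config.initial (M : OmegaTM T) (u : ℕ → T) : M.Config :=
  ⟨M.init, fun k => M.embed (u k), 0, 1, ∅⟩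

theorem Config.initial_form (u : ℕ → T) : (Config.initial M u).form u =
    [.inl (.cell (u 0) (M.embed (u 0)) true (some M.init)), .inl .edge] := by
  simp [form, initial, sym]

theorem Config.initial_good (u : ℕ → T) : (Config.initial M u).Good u :=
  ⟨by simp [initial], by simp [initial], by simp [initial], fun _ _ => rfl⟩

theorem mem_lang_of_mem_lang_grammar [Fintype T] {σ : AccSigma} {ρ : AccRho} {u : ℕ → T}
    (h : u ∈ (M.grammar ρ).Lang σ ρ .nl) : u ∈ M.Lang σ ρ := by
  obtain ⟨s, d, h0, hstep, hlen, hmatch, hacc⟩ := (M.mem_lang_grammar σ ρ u).1 h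
  obtain ⟨a, hd0, hs1⟩ := rewrites_start (h0 ▸ (hstep 0).2)
  have hshape (i : ℕ) : Shaped (s (i + 1)) := by
    induction i with
    | zero =>
      exact ⟨[.inl (.cell a (M.embed a) true (some M.init))], by simp [hs1], by simp [letter]⟩
    | succ i ih => exact (ih.rewrites (hstep (i + 1)).2).1
  have hpersist (i j k : ℕ) (b : T) (hb : (s (i + 1))[k]?.bind letter = some b) :
      (s (i + j + 1))[k]?.bind letter = some b := by
    induction j with
    | zero => exact hb
    | succ j ih => exact ((hshape (i + j)).rewrites (hstep (i + j + 1)).2).2 k b ih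
  have hterm (n : ℕ) : ∃ i, ∀ k < n, (s (i + 1))[k]? = some (.inr (u k)) := by
    obtain ⟨i, hi⟩ := hlen (n + 1)
    have hget (k : ℕ) (hk : k < n + 1) : (s i)[k]? = some (.inr (u k)) := by
      have hk' : k < (termPrefix (s i)).length := by omega
      have := hmatch i k hk'
      refine termPrefix_getElem? _ _ _ ?_
      simpa [List.getElem?_eq_getElem hk'] using this
    cases i with
    | zero => simpa [h0] using hget 0 (by omega)
    | succ i => exact ⟨i, fun k hk => hget k (by omega)⟩
  have hu (i k : ℕ) (b : T) (hb : (s (i + 1))[k]?.bind letter = some b) : b = u k := by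
    obtain ⟨j, hj⟩ := hterm (k + 1)
    have h1 := hpersist i j k b hb
    have h2 := hpersist j i k (u k) (by rw [hj k (by omega)]; rfl)
    rw [Nat.add_comm j i, h1] at h2
    exact Option.some.inj h2
  have ha : a = u 0 := hu 0 0 a (by simp [hs1, letter])
  have hnext (i : ℕ) (C : {C : M.Config // s (i + 1) = C.form u ∧ C.Good u}) :
      ∃ C' : {C : M.Config // s (i + 1 + 1) = C.form u ∧ C.Good u},
        M.Trans C.1.q C.1.tape C.1.pos C'.1.q C'.1.tape C'.1.pos ∧
        M.ruleState (d (i + 1)) = C.1.q ∧ C.1.done ⊆ C'.1.done := by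
    obtain ⟨C', h1, h2, h3⟩ := Config.exists_of_rewrites C.2.2 (hstep (i + 1)).1
      (C.2.1 ▸ (hstep (i + 1)).2) (hu (i + 1))
    exact ⟨⟨C', h1, h2⟩, h3⟩
  choose next hnext using hnext
  let C (i : ℕ) : {C : M.Config // s (i + 1) = C.form u ∧ C.Good u} :=
    Nat.rec ⟨.initial M u, by rw [hs1, Config.initial_form, ha], Config.initial_good u⟩ next i
  have hC (i : ℕ) : M.Trans (C i).1.q (C i).1.tape (C i).1.pos
      (C (i + 1)).1.q (C (i + 1)).1.tape (C (i + 1)).1.pos ∧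
      M.ruleState (d (i + 1)) = (C i).1.q ∧ (C i).1.done ⊆ (C (i + 1)).1.done := hnext i (C i)
  have hmono : Monotone fun i => (C i).1.done := monotone_nat_of_le_succ fun i => (hC i).2.2
  have hdone (n : ℕ) : ∃ i, ∀ k < n, k ∈ (C i).1.done :=
    (hterm n).imp fun i hi k hk => (Config.form_eq_terminal ((C i).2.1 ▸ hi k hk)).1
  refine ⟨fun i => (C i).1.q, fun i => (C i).1.tape, fun i => (C i).1.pos, rfl, fun _ => rfl, rfl,
    fun i => (hC i).1, fun n => ?_, fun n => ?_, ?_⟩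
  · obtain ⟨i, hi⟩ := hdone n
    exact ⟨i, not_lt.1 fun hlt => (C i).2.2.pos_notMem (hi _ hlt)⟩
  · obtain ⟨i, hi⟩ := hdone (n + 1)
    refine ⟨i, fun j hj he => (C j).2.2.pos_notMem ?_⟩
    subst he
    exact hmono hj (hi _ (Nat.lt_succ_self _))
  · have hq : (fun i => (C i).1.q) = fun i => (M.ruleState ∘ d) (i + 1) :=
      funext fun i => (hC i).2.1.symm
    have h01 : (M.ruleState ∘ d) 0 = (M.ruleState ∘ d) 1 := by
      simp only [Function.comp_apply, hd0]
      exact (hC 0).2.1.symm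
    unfold IsAccepting at hacc ⊢
    rwa [hq, sigmaSet_tail σ _ h01]

/-- A head that moves by at most one cell at a time visits every cell to the right of its current
position. -/
theorem exists_pos_eq {pos : ℕ → ℕ} (hle : ∀ i, pos (i + 1) ≤ pos i + 1)
    (hunb : ∀ n, ∃ i, n ≤ pos i) {i k : ℕ} (hk : pos i ≤ k) : ∃ j, i ≤ j ∧ pos j = k := by
  by_contra! hne
  have hlt (j : ℕ) : pos (i + j) < k := by
    induction j with
    | zero => have := hne i le_rfl; grind
    | succ j ih =>
      have h1 := hle (i + j)
      have h2 := hne (i + j + 1) (by omega)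
      rw [← Nat.add_assoc]
      omega
  have hbound (j : ℕ) : pos j ≤ pos 0 + j := by
    induction j with
    | zero => simp
    | succ j ih => have := hle j; omega
  obtain ⟨j, hj⟩ := hunb (k + pos 0 + i + 1)
  have h1 := hbound j
  have h2 := hlt (j - i)
  rw [Nat.add_sub_cancel' (by omega)] at h2
  omega

theorem mem_lang_grammar_of_mem_lang [Fintype T] {σ : AccSigma} {ρ : AccRho} {u : ℕ → T}
    (h : u ∈ M.Lang σ ρ) : u ∈ (M.grammar ρ).Lang σ ρ .nl := by
  obtain ⟨q, tape, pos, hq0, htape0, hpos0, hstep, hcomplete, hosc, hacc⟩ := h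
  have hle (i : ℕ) : pos (i + 1) ≤ pos i + 1 := by
    obtain ⟨g, m, -, -, hm⟩ := hstep i
    cases m <;> simp only [moveHead] at hm <;> omega
  let width (i : ℕ) : ℕ := Nat.rec 1 (fun i n => max n (pos (i + 1) + 1)) i
  have hwidth (i : ℕ) : width (i + 1) = max (width i) (pos (i + 1) + 1) := rfl
  let C (i : ℕ) : M.Config := ⟨q i, tape i, pos i, width i, {k | ∀ j, i ≤ j → pos j ≠ k}⟩
  have hlt (i : ℕ) : pos i < width i := by
    cases i with
    | zero => simp [hpos0, width]
    | succ i => rw [hwidth]; omega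
  have htape (i : ℕ) : ∀ k, width i ≤ k → tape i k = M.embed (u k) := by
    induction i with
    | zero => exact fun k _ => htape0 k
    | succ i ih =>
      intro k hk
      rw [hwidth] at hk
      obtain ⟨g, m, -, ht, -⟩ := hstep i
      have := hlt i
      rw [ht, Function.update_of_ne (by omega), ih k (by omega)]
  have hrule (i : ℕ) : ∃ p, M.Valid p ∧ M.ruleState p = q i ∧
      M.Rewrites p ((C i).form u) ((C (i + 1)).form u) := by
    refine Config.exists_rewrites u (C := C i) (C' := C (i + 1)) (hlt i) (htape i) (hwidth i)
      ?_ ?_ ?_ ?_ (hstep i)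
    · intro k hk
      refine ⟨fun hd j hj => ?_, fun hd j hj => hd j (by omega)⟩
      obtain rfl | hj := hj.eq_or_lt
      · exact hk.symm
      · exact hd j hj
    · intro hd
      by_contra hne
      have := hle i
      obtain ⟨j, hj, he⟩ := exists_pos_eq hle hcomplete (i := i + 1) (k := pos i)
        (by simp only [C] at hne; omega)
      exact hd j hj he
    · exact fun hd => hd i le_rfl rfl
    · exact fun hd => hd (i + 1) (by omega) rfl
  choose p hvalid hstate hrewrites using hrule
  have hterm (i k : ℕ) (a : T) (ha : ((C i).form u)[k]? = some (.inr a)) : a = u k :=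
    (Config.form_eq_terminal ha).2
  refine (M.mem_lang_grammar σ ρ u).2
    ⟨fun i => Nat.casesOn i [.inl .start] fun i => (C i).form u,
      fun i => Nat.casesOn i (.start (u 0)) p, rfl, ?_, fun n => ?_, ?_, ?_⟩
  · rintro (_ | i)
    · refine ⟨trivial, [], [], rfl, ?_⟩
      simp [C, width, Config.form, Config.sym, ruleRhs, hpos0, htape0, hq0]
      exact ⟨0, hpos0⟩
    · exact ⟨hvalid i, hrewrites i⟩
  · choose b hb using hosc
    obtain ⟨i, hi⟩ : ∃ i, ∀ k < n, b k ≤ i :=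
      ⟨(Finset.range n).sup b, fun k hk => Finset.le_sup (f := b) (Finset.mem_range.2 hk)⟩
    have hdone (k : ℕ) (hk : k < n) : k ∈ (C i).done := fun j hj =>
      hb k j ((hi k hk).trans hj)
    have hn : n ≤ pos i := not_lt.1 fun hn => hdone _ hn i le_rfl rfl
    refine ⟨i + 1, le_length_termPrefix _ _ fun k hk => ⟨u k, ?_⟩⟩
    have hkw : k < (C i).width := hk.trans_le (hn.trans (hlt i).le)
    simp [Config.form_getElem?, Config.sym, hkw, hdone k hk]
  · rintro (_ | i)
    · intro k hk
      simp [termPrefix] at hk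
    · intro k hk
      exact hterm i k _ (termPrefix_getElem? _ _ _ (List.getElem?_eq_getElem hk))
  · set d : ℕ → Rule T M.Γ M.Q := fun i => Nat.casesOn i (.start (u 0)) p
    have hq : (fun i => (M.ruleState ∘ d) (i + 1)) = q := funext hstate
    have h01 : (M.ruleState ∘ d) 0 = (M.ruleState ∘ d) 1 := ((hstate 0).trans hq0).symm
    unfold IsAccepting at hacc ⊢
    rwa [← sigmaSet_tail σ _ h01, hq]

end OmegaTM

end OmegaFormal

/-- Lemma: 𝓛_{σ,ρ}(ω-TM) ⊆ 𝓛_{σ,ρ,nl}(ω-CSG) for every acceptance mode (σ,ρ). -/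
theorem tm_subset_csg_nl (T : Type) [Fintype T] (σ : AccSigma) (ρ : AccRho) :
    TMLang T σ ρ ⊆ GLang T OmegaPSG.IsCSG σ ρ DerivMode.nl := by
  rintro L ⟨M, rfl⟩
  exact ⟨M.grammar ρ, M.grammar_isCSG ρ, Set.ext fun u =>
    ⟨OmegaTM.mem_lang_grammar_of_mem_lang, OmegaTM.mem_lang_of_mem_lang_grammar⟩⟩
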